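/- Let N ≥ 2, let H be a Finsler norm on ℝ^N, and let B satisfy assumption (h_B) with p ≥ 2 and parameters κ ∈ [0,1], γ > 0, Γ > 0. Let q > 1 and let u be a stable weak solution of −div(B'(H(∇u))∇H(∇u)) = |u|^{q−1}u in ℝ^N. Suppose 0 < Γκ^{p−2}(p−1) < 1, q > κ^{2−p}γ^{−1}, and N < f(q) := 2[κ^{2−p}γ^{−1}(q−1) + 2q + 2√(q(q − κ^{2−p}γ^{−1}))] / [κ^{2−p}γ^{−1}(q−1)]. Then u ≡ 0. -/

import Mathlib

open MeasureTheory Real Set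
open scoped RealInnerProductSpace

noncomputable section

/-- A Finsler norm on `ℝ^N`: a norm of class `C²` away from the origin whose
open unit ball is uniformly convex. -/
def IsFinslerNorm {N : ℕ} (H : EuclideanSpace ℝ (Fin N) → ℝ) : Prop :=
  (∀ x, H x = 0 ↔ x = 0) ∧
  (∀ (c : ℝ) (x : EuclideanSpace ℝ (Fin N)), H (c • x) = |c| * H x) ∧
  (∀ x y, H (x + y) ≤ H x + H y) ∧
  ContDiffOn ℝ 2 H {(0 : EuclideanSpace ℝ (Fin N))}ᶜ ∧
  ∃ Λ : ℝ, 0 < Λ ∧ ∀ ξ : EuclideanSpace ℝ (Fin N), H ξ = 1 →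
    ∀ v : EuclideanSpace ℝ (Fin N), ⟪gradient H ξ, v⟫ = 0 →
      Λ * ‖v‖ ^ 2 ≤ ⟪fderiv ℝ (gradient H) ξ v, v⟫

/-- Assumption `(h_B)` with parameters `p, κ, γ, Γ`. -/
def SatisfiesHB (B : ℝ → ℝ) (p κ γ Γ : ℝ) : Prop :=
  ContDiffOn ℝ 2 B (Set.Ioi 0) ∧ B 0 = 0 ∧ deriv B 0 = 0 ∧
  (∀ t : ℝ, 0 < t → 0 < B t ∧ 0 < deriv B t ∧ 0 < deriv (deriv B) t) ∧
  1 < p ∧ 0 ≤ κ ∧ κ ≤ 1 ∧ 0 < γ ∧ 0 < Γ ∧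
  (∀ t : ℝ, 0 < t →
    γ * (κ + t) ^ (p - 2) * t ≤ deriv B t ∧ deriv B t ≤ Γ * (κ + t) ^ (p - 2) * t) ∧
  (∀ t : ℝ, 0 < t →
    γ * (p - 1) * (κ + t) ^ (p - 2) ≤ deriv (deriv B) t ∧
      deriv (deriv B) t ≤ Γ * (p - 1) * (κ + t) ^ (p - 2))

/-- `u` is a weak solution of `-div(B'(H(∇u)) ∇H(∇u)) = |u|^{q-1} u` in `Ω`. -/
def IsWeakSolutionOn {N : ℕ} (Ω : Set (EuclideanSpace ℝ (Fin N))) (B : ℝ → ℝ)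
    (H : EuclideanSpace ℝ (Fin N) → ℝ) (u : EuclideanSpace ℝ (Fin N) → ℝ) (q : ℝ) : Prop :=
  ∀ φ : EuclideanSpace ℝ (Fin N) → ℝ, ContDiff ℝ 1 φ → HasCompactSupport φ → tsupport φ ⊆ Ω →
    ∫ x in Ω, deriv B (H (gradient u x)) * ⟪gradient H (gradient u x), gradient φ x⟫
      = ∫ x in Ω, |u x| ^ (q - 1) * u x * φ x

/-- Stability of the linearized operator of `u`, tested against `C¹` functions compactly
supported in `S ⊆ Ω` (take `S = Ω` for stability, `S = Ω \ K` for stability outside a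
compact set `K`). -/
def IsStableOn {N : ℕ} (Ω S : Set (EuclideanSpace ℝ (Fin N))) (B : ℝ → ℝ)
    (H : EuclideanSpace ℝ (Fin N) → ℝ) (u : EuclideanSpace ℝ (Fin N) → ℝ) (q : ℝ) : Prop :=
  ∀ φ : EuclideanSpace ℝ (Fin N) → ℝ, ContDiff ℝ 1 φ → HasCompactSupport φ → tsupport φ ⊆ S →
    0 ≤ (∫ x in Ω, deriv (deriv B) (H (gradient u x)) *
            ⟪gradient H (gradient u x), gradient φ x⟫ ^ 2)
        + (∫ x in Ω, deriv B (H (gradient u x)) *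
            ⟪fderiv ℝ (gradient H) (gradient u x) (gradient φ x), gradient φ x⟫)
        - ∫ x in Ω, q * |u x| ^ (q - 1) * φ x ^ 2


theorem rpow_mul_rpow_le_young {σ ρ k ε : ℝ} (hσ : 0 ≤ σ) (hρ : σ < ρ)
    (hε : 0 < ε) :
    ∃ C : ℝ, 0 ≤ C ∧ ∀ w y : ℝ, 0 ≤ w → 0 ≤ y →
      w ^ σ * y ^ k ≤ ε * w ^ ρ + C * y ^ (k * ρ / (ρ - σ)) := by
  have hd : 0 < ρ - σ := sub_pos.2 hρ
  set δ : ℝ := ε ^ (1 / (ρ - σ)) with hδ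
  have hδ0 : 0 < δ := rpow_pos_of_pos hε _
  have hδε : δ ^ (ρ - σ) = ε := by
    rw [hδ, ← rpow_mul hε.le, one_div_mul_cancel hd.ne', rpow_one]
  refine ⟨(1 / δ) ^ σ, by positivity, fun w y hw hy => ?_⟩
  set v : ℝ := y ^ (k / (ρ - σ)) with hv
  have hv0 : 0 ≤ v := by positivity
  have hvk : y ^ k = v ^ (ρ - σ) := by
    rw [hv, ← rpow_mul hy, div_mul_cancel₀ _ hd.ne']
  have hvρ : y ^ (k * ρ / (ρ - σ)) = v ^ ρ := by
    rw [hv, ← rpow_mul hy]; congr 1; ring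
  have hsum : ∀ z : ℝ, 0 ≤ z → z ^ σ * z ^ (ρ - σ) = z ^ ρ := fun z hz => by
    rw [← rpow_add_of_nonneg hz hσ hd.le]; congr 1; ring
  rw [hvk, hvρ]
  rcases le_total v (δ * w) with h | h
  · have h1 : v ^ (ρ - σ) ≤ ε * w ^ (ρ - σ) := by
      rw [← hδε, ← mul_rpow hδ0.le hw]
      exact rpow_le_rpow hv0 h hd.le
    calc w ^ σ * v ^ (ρ - σ) ≤ w ^ σ * (ε * w ^ (ρ - σ)) := by gcongr
      _ = ε * w ^ ρ := by rw [← hsum w hw]; ring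
      _ ≤ _ := le_add_of_nonneg_right (by positivity)
  · have h1 : w ^ σ ≤ (1 / δ) ^ σ * v ^ σ := by
      rw [← mul_rpow (by positivity) hv0]
      refine rpow_le_rpow hw ?_ hσ
      rw [one_div, ← div_eq_inv_mul, le_div_iff₀ hδ0, mul_comm]
      exact h
    calc w ^ σ * v ^ (ρ - σ) ≤ (1 / δ) ^ σ * v ^ σ * v ^ (ρ - σ) := by gcongr
      _ = (1 / δ) ^ σ * v ^ ρ := by rw [← hsum v hv0]; ring
      _ ≤ _ := le_add_of_nonneg_left (by positivity)

theorem exists_exponent {n q K : ℝ} (hq : 1 < q) (hK : 0 < K) (hKq : K < q)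
    (hn : n < 2 * (K * (q - 1) + 2 * q + 2 * √(q * (q - K))) / (K * (q - 1))) :
    ∃ b : ℝ, 0 < b ∧ K * (b + 1) ^ 2 < q * (2 * b + 1) ∧
      n < 2 * (q + 2 * b + 1) / (q - 1) := by
  have hq1 : 0 < q - 1 := by linarith
  set s := √(q * (q - K)) with hs
  have hqK : 0 < q * (q - K) := mul_pos (by linarith) (by linarith)
  have hs0 : 0 < s := Real.sqrt_pos.2 hqK
  have hs2 : s ^ 2 = q * (q - K) := Real.sq_sqrt hqK.le
  rw [lt_div_iff₀ (by positivity)] at hn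
  set d := 2 * (K * (q - 1) + 2 * q + 2 * s) - n * (K * (q - 1)) with hd
  have hd0 : 0 < d := by linarith
  set θ := 4 * s / (d + 4 * s) with hθ
  have hden : 0 < d + 4 * s := by positivity
  have hθ0 : 0 < θ := by positivity
  have hθe : θ * (d + 4 * s) = 4 * s := div_mul_cancel₀ _ hden.ne'
  have hθ1 : θ < 1 := by rw [hθ, div_lt_one hden]; linarith
  have hβ : ((q + θ * s) / K) * K = q + θ * s := div_mul_cancel₀ _ hK.ne'
  set β := (q + θ * s) / K with hβd
  refine ⟨β - 1, ?_, ?_, ?_⟩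
  · have : 1 < β := by rw [hβd, lt_div_iff₀ hK]; nlinarith
    linarith
  · have h1 : K * (K * β ^ 2 - q * (2 * β - 1)) = (θ ^ 2 - 1) * s ^ 2 := by
      have : K * (K * β ^ 2 - q * (2 * β - 1)) = (β * K) ^ 2 - 2 * q * (β * K) + q * K := by ring
      rw [this, hβ, sub_mul, one_mul, hs2]
      linear_combination (θ ^ 2 - θ ^ 2) * hs2 + θ ^ 2 * hs2
    have h2 : (θ ^ 2 - 1) * s ^ 2 < 0 :=
      mul_neg_of_neg_of_pos (by nlinarith) (by positivity)
    have h3 : K * β ^ 2 - q * (2 * β - 1) < 0 := by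
      by_contra h
      push Not at h
      nlinarith [mul_nonneg hK.le h]
    have e : β - 1 + 1 = β := by ring
    rw [e]; linarith
  · rw [lt_div_iff₀ hq1]
    refine lt_of_mul_lt_mul_right ?_ hK.le
    have : 2 * (q + 2 * (β - 1) + 1) * K = 2 * (K * (q - 1) + 2 * (β * K)) := by ring
    rw [this, hβ]
    nlinarith

theorem exists_small_absorbing {q K c₁ c₂ : ℝ} (h : K * c₁ < q * c₂)
    (hc₂ : 0 < c₂) :
    ∃ ε : ℝ, 0 < ε ∧ ε < c₂ ∧ (K * c₁ + ε) * (1 + ε) < (q - ε) * (c₂ - ε) := by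
  have hcont : Continuous fun ε : ℝ => (q - ε) * (c₂ - ε) - (K * c₁ + ε) * (1 + ε) := by fun_prop
  have h0 : ∀ᶠ ε in nhds (0 : ℝ), 0 < (q - ε) * (c₂ - ε) - (K * c₁ + ε) * (1 + ε) :=
    hcont.tendsto 0 |>.eventually (lt_mem_nhds (by simpa using h))
  have h1 : ∀ᶠ ε in nhdsWithin (0 : ℝ) (Ioi 0), 0 < ε ∧ ε < c₂ ∧
      0 < (q - ε) * (c₂ - ε) - (K * c₁ + ε) * (1 + ε) := by
    filter_upwards [self_mem_nhdsWithin, nhdsWithin_le_nhds (gt_mem_nhds hc₂),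
      nhdsWithin_le_nhds h0] with ε a b c using ⟨a, b, c⟩
  obtain ⟨ε, h1, h2, h3⟩ := h1.exists
  exact ⟨ε, h1, h2, by linarith⟩

/-- The absorption of the cut-off error before localisation. -/
theorem weighted_error_le {p q κ b c ε : ℝ} (hp : 2 ≤ p) (hκ0 : 0 ≤ κ) (hκ : κ ≤ 1)
    (hq : 1 < q) (hpq : p - 1 < q) (hb : 0 < b) (hc : 0 ≤ c) (hε : 0 < ε) :
    ∃ C : ℝ, 0 ≤ C ∧ ∀ h w y : ℝ, 0 ≤ h → 0 ≤ w → 0 ≤ y →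
      (κ + h) ^ (p - 2) * w ^ (2 * b) * (w * (c * y)) ^ 2 ≤
        ε * ((κ + h) ^ (p - 2) * w ^ (2 * b) * h ^ 2 + w ^ (q + 2 * b + 1)) +
        C * (y ^ (2 * (q + 2 * b + 1) / (q - 1)) +
          y ^ (p * (q + 2 * b + 1) / (q - p + 1))) := by
  set τ : ℝ := c / √ε with hτ
  have hsε : 0 < √ε := Real.sqrt_pos.2 hε
  have hτ0 : 0 ≤ τ := by positivity
  set M : ℝ := 2 ^ (p - 2) * c ^ 2 with hM
  have hM0 : 0 ≤ M := by positivity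
  set M' : ℝ := M * τ ^ (p - 2) with hM'
  have hM'0 : 0 ≤ M' := by positivity
  obtain ⟨C₁, hC₁, hY₁⟩ := rpow_mul_rpow_le_young (σ := 2 * b + 2) (ρ := q + 2 * b + 1) (k := 2)
    (ε := ε / (2 * (M + 1))) (by linarith) (by linarith) (by positivity)
  obtain ⟨C₂, hC₂, hY₂⟩ := rpow_mul_rpow_le_young (σ := 2 * b + p) (ρ := q + 2 * b + 1) (k := p)
    (ε := ε / (2 * (M' + 1))) (by linarith) (by linarith) (by positivity)
  have e₁ : q + 2 * b + 1 - (2 * b + 2) = q - 1 := by ring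
  have e₂ : q + 2 * b + 1 - (2 * b + p) = q - p + 1 := by ring
  rw [e₁] at hY₁
  rw [e₂] at hY₂
  refine ⟨M * C₁ + M' * C₂, by positivity, fun h w y hh hw hy => ?_⟩
  have hP0 : 0 ≤ (κ + h) ^ (p - 2) := by positivity
  have hW0 : 0 ≤ w ^ (2 * b) := by positivity
  have hs1 : 0 ≤ y ^ (2 * (q + 2 * b + 1) / (q - 1)) := by positivity
  have hs2 : 0 ≤ y ^ (p * (q + 2 * b + 1) / (q - p + 1)) := by positivity
  have hρ0 : 0 ≤ w ^ (q + 2 * b + 1) := by positivity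
  rcases le_total (w * (c * y)) (√ε * h) with hle | hle
  · have h1 : (w * (c * y)) ^ 2 ≤ ε * h ^ 2 := by
      calc (w * (c * y)) ^ 2 ≤ (√ε * h) ^ 2 := by gcongr
        _ = ε * h ^ 2 := by rw [mul_pow, Real.sq_sqrt hε.le]
    calc (κ + h) ^ (p - 2) * w ^ (2 * b) * (w * (c * y)) ^ 2
        ≤ (κ + h) ^ (p - 2) * w ^ (2 * b) * (ε * h ^ 2) := by gcongr
      _ = ε * ((κ + h) ^ (p - 2) * w ^ (2 * b) * h ^ 2) := by ring
      _ ≤ ε * ((κ + h) ^ (p - 2) * w ^ (2 * b) * h ^ 2 + w ^ (q + 2 * b + 1)) := by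
        gcongr; linarith
      _ ≤ _ := le_add_of_nonneg_right (by positivity)
  · have hhle : h ≤ τ * (w * y) := by
      have : h ≤ (w * (c * y)) / √ε := by rw [le_div_iff₀ hsε, mul_comm]; exact hle
      refine this.trans (le_of_eq ?_)
      rw [hτ]; ring
    have hP : (κ + h) ^ (p - 2) ≤ 2 ^ (p - 2) * (1 + τ ^ (p - 2) * (w ^ (p - 2) * y ^ (p - 2))) := by
      rw [← mul_rpow hw hy, ← mul_rpow hτ0 (by positivity)]
      set z := τ * (w * y)
      have hz : 0 ≤ z := by positivity
      have hp2 : 0 ≤ p - 2 := by linarith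
      have hzp : 0 ≤ z ^ (p - 2) := by positivity
      rcases le_total z 1 with hz1 | hz1
      · calc (κ + h) ^ (p - 2) ≤ 2 ^ (p - 2) := rpow_le_rpow (by positivity) (by linarith) hp2
          _ = 2 ^ (p - 2) * 1 := by ring
          _ ≤ _ := by gcongr; linarith
      · calc (κ + h) ^ (p - 2) ≤ (2 * z) ^ (p - 2) :=
            rpow_le_rpow (by positivity) (by linarith) hp2
          _ = 2 ^ (p - 2) * z ^ (p - 2) := mul_rpow (by norm_num) hz
          _ ≤ _ := by gcongr; linarith
    have hw2 : w ^ (2 * b + 2) = w ^ (2 * b) * w ^ 2 := by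
      rw [rpow_add_of_nonneg hw (by positivity) (by norm_num), rpow_two]
    have hwp : w ^ (2 * b + p) = w ^ (2 * b) * (w ^ 2 * w ^ (p - 2)) := by
      rw [← rpow_two, ← rpow_add_of_nonneg hw (by norm_num) (by linarith),
        ← rpow_add_of_nonneg hw (by positivity) (by linarith)]
      congr 1; ring
    have hyp : y ^ p = y ^ 2 * y ^ (p - 2) := by
      rw [← rpow_two, ← rpow_add_of_nonneg hy (by norm_num) (by linarith)]
      congr 1; ring
    have hY₁' := hY₁ w y hw hy
    have hY₂' := hY₂ w y hw hy
    have hε₁ : M * (ε / (2 * (M + 1))) ≤ ε / 2 := by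
      rw [← mul_div_assoc, div_le_div_iff₀ (by positivity) (by norm_num)]; nlinarith
    have hε₂ : M' * (ε / (2 * (M' + 1))) ≤ ε / 2 := by
      rw [← mul_div_assoc, div_le_div_iff₀ (by positivity) (by norm_num)]; nlinarith
    calc (κ + h) ^ (p - 2) * w ^ (2 * b) * (w * (c * y)) ^ 2
        ≤ (2 ^ (p - 2) * (1 + τ ^ (p - 2) * (w ^ (p - 2) * y ^ (p - 2)))) * w ^ (2 * b) *
            (w * (c * y)) ^ 2 := by gcongr
      _ = M * (w ^ (2 * b + 2) * y ^ (2 : ℝ)) + M' * (w ^ (2 * b + p) * y ^ p) := by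
        rw [hw2, hwp, hyp, hM', hM, rpow_two]; ring
      _ ≤ M * (ε / (2 * (M + 1)) * w ^ (q + 2 * b + 1) +
            C₁ * y ^ (2 * (q + 2 * b + 1) / (q - 1))) +
          M' * (ε / (2 * (M' + 1)) * w ^ (q + 2 * b + 1) +
            C₂ * y ^ (p * (q + 2 * b + 1) / (q - p + 1))) := by gcongr
      _ = (M * (ε / (2 * (M + 1))) + M' * (ε / (2 * (M' + 1)))) * w ^ (q + 2 * b + 1) +
          (M * C₁ * y ^ (2 * (q + 2 * b + 1) / (q - 1)) +
            M' * C₂ * y ^ (p * (q + 2 * b + 1) / (q - p + 1))) := by ring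
      _ ≤ ε * w ^ (q + 2 * b + 1) +
          (M * C₁ + M' * C₂) * (y ^ (2 * (q + 2 * b + 1) / (q - 1)) +
            y ^ (p * (q + 2 * b + 1) / (q - p + 1))) := by
        have h1 := mul_nonneg (mul_nonneg hM0 hC₁) hs2
        have h2 := mul_nonneg (mul_nonneg hM'0 hC₂) hs1
        refine add_le_add (mul_le_mul_of_nonneg_right (by linarith) hρ0) ?_
        rw [add_mul (M * C₁)]
        linarith
      _ ≤ _ := by
        gcongr
        exact le_add_of_nonneg_left (by positivity)

/-- Young's inequality for the cut-off error, with cut-off `t ^ m`, `0 ≤ t ≤ 1`. -/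
theorem exists_cutoff_error_le {p q κ b c ε : ℝ} {m : ℕ} (hp : 2 ≤ p) (hκ0 : 0 ≤ κ) (hκ : κ ≤ 1)
    (hq : 1 < q) (hpq : p - 1 < q) (hb : 0 < b) (hc : 0 ≤ c) (hε : 0 < ε) (hm1 : 2 ≤ m)
    (hm : p * (q + 2 * b + 1) / (q - p + 1) ≤ m) :
    ∃ C : ℝ, 0 ≤ C ∧ ∀ R h w t D : ℝ, 1 ≤ R → 0 ≤ h → 0 ≤ w → 0 ≤ t → t ≤ 1 → 0 ≤ D →
      D ≤ c * t ^ (m - 1) / R →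
      (κ + h) ^ (p - 2) * w ^ (2 * b) * (w * D) ^ 2 ≤
        ε * ((κ + h) ^ (p - 2) * w ^ (2 * b) * h ^ 2 * (t ^ m) ^ 2 +
          w ^ (q + 2 * b + 1) * (t ^ m) ^ 2) +
        C * R ^ (-(2 * (q + 2 * b + 1) / (q - 1))) := by
  set s₁ := 2 * (q + 2 * b + 1) / (q - 1) with hs₁
  set s₂ := p * (q + 2 * b + 1) / (q - p + 1) with hs₂
  have hq1 : 0 < q - 1 := by linarith
  have hqp : 0 < q - p + 1 := by linarith
  have hs₁0 : 0 ≤ s₁ := by positivity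
  have hs12 : s₁ ≤ s₂ := by
    rw [hs₁, hs₂, div_le_div_iff₀ hq1 hqp]
    have : 0 ≤ q + 2 * b + 1 := by linarith
    have h2 : 2 * (q - p + 1) ≤ p * (q - 1) := by nlinarith
    nlinarith [mul_le_mul_of_nonneg_left h2 this]
  obtain ⟨C, hC, H⟩ := weighted_error_le hp hκ0 hκ hq hpq hb hc hε
  refine ⟨2 * C, by positivity, fun R h w t D hR hh hw ht0 ht1 hD0 hD => ?_⟩
  have hR0 : 0 < R := by linarith
  rcases ht0.eq_or_lt with rfl | ht
  · have : D = 0 := by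
      refine le_antisymm (hD.trans ?_) hD0
      rw [zero_pow (by omega)]; simp
    rw [this]
    have e : (κ + h) ^ (p - 2) * w ^ (2 * b) * (w * 0) ^ 2 = 0 := by simp
    rw [e]
    positivity
  · set y := 1 / (R * t) with hy
    have hy0 : 0 ≤ y := by positivity
    have hDy : D ≤ c * y * t ^ m := by
      refine hD.trans (le_of_eq ?_)
      obtain ⟨k, rfl⟩ : ∃ k, m = k + 1 := ⟨m - 1, by omega⟩
      rw [hy, Nat.add_sub_cancel, pow_succ]
      field_simp
    have hys : ∀ s : ℝ, s₁ ≤ s → s ≤ m → y ^ s * (t ^ m) ^ 2 ≤ R ^ (-s₁) := by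
      intro s h1 h2
      have hs0 : 0 ≤ s := hs₁0.trans h1
      have : y ^ s = R ^ (-s) * t ^ (-s) := by
        rw [hy, one_div, inv_rpow (by positivity), mul_rpow hR0.le ht.le, mul_inv,
          rpow_neg hR0.le, rpow_neg ht.le]
      rw [this, ← pow_mul, ← rpow_natCast, mul_assoc, ← rpow_add ht]
      calc R ^ (-s) * t ^ (-s + ((m * 2 : ℕ) : ℝ)) ≤ R ^ (-s₁) * 1 := by
            refine mul_le_mul (rpow_le_rpow_of_exponent_le hR (by linarith)) ?_
              (by positivity) (by positivity)
            · refine rpow_le_one ht.le ht1 ?_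
              push_cast
              have : (0 : ℝ) ≤ m := by positivity
              linarith
        _ = _ := mul_one _
    have hT0 : 0 ≤ (t ^ m) ^ 2 := by positivity
    have hP0 : 0 ≤ (κ + h) ^ (p - 2) := by positivity
    have hW0 : 0 ≤ w ^ (2 * b) := by positivity
    calc (κ + h) ^ (p - 2) * w ^ (2 * b) * (w * D) ^ 2
        ≤ (κ + h) ^ (p - 2) * w ^ (2 * b) * (w * (c * y * t ^ m)) ^ 2 := by gcongr
      _ = ((κ + h) ^ (p - 2) * w ^ (2 * b) * (w * (c * y)) ^ 2) * (t ^ m) ^ 2 := by ring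
      _ ≤ (ε * ((κ + h) ^ (p - 2) * w ^ (2 * b) * h ^ 2 + w ^ (q + 2 * b + 1)) +
        C * (y ^ s₁ + y ^ s₂)) * (t ^ m) ^ 2 := by
          gcongr
          exact H h w y hh hw hy0
      _ = ε * ((κ + h) ^ (p - 2) * w ^ (2 * b) * h ^ 2 * (t ^ m) ^ 2 +
          w ^ (q + 2 * b + 1) * (t ^ m) ^ 2) +
          C * (y ^ s₁ * (t ^ m) ^ 2 + y ^ s₂ * (t ^ m) ^ 2) := by ring
      _ ≤ ε * ((κ + h) ^ (p - 2) * w ^ (2 * b) * h ^ 2 * (t ^ m) ^ 2 +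
          w ^ (q + 2 * b + 1) * (t ^ m) ^ 2) + C * (R ^ (-s₁) + R ^ (-s₁)) := by
          gcongr
          · exact hys _ le_rfl (hs12.trans hm)
          · exact hys _ hs12 hm
      _ = _ := by ring

namespace IsFinslerNorm

variable {N : ℕ} {H : EuclideanSpace ℝ (Fin N) → ℝ}

theorem map_zero (hH : IsFinslerNorm H) : H 0 = 0 := (hH.1 0).2 rfl

theorem map_neg (hH : IsFinslerNorm H) (x : EuclideanSpace ℝ (Fin N)) : H (-x) = H x := by
  simpa using hH.2.1 (-1) x

theorem nonneg (hH : IsFinslerNorm H) (x : EuclideanSpace ℝ (Fin N)) : 0 ≤ H x := by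
  have h := hH.2.2.1 x (-x)
  rw [add_neg_cancel, hH.map_zero, hH.map_neg] at h
  linarith

theorem pos (hH : IsFinslerNorm H) {x : EuclideanSpace ℝ (Fin N)} (hx : x ≠ 0) : 0 < H x :=
  (hH.nonneg x).lt_of_ne fun h => hx ((hH.1 x).1 h.symm)

theorem contDiffAt (hH : IsFinslerNorm H) {x : EuclideanSpace ℝ (Fin N)} (hx : x ≠ 0) :
    ContDiffAt ℝ 2 H x :=
  hH.2.2.2.1.contDiffAt (isOpen_compl_singleton.mem_nhds hx)

theorem differentiableAt (hH : IsFinslerNorm H) {x : EuclideanSpace ℝ (Fin N)} (hx : x ≠ 0) :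
    DifferentiableAt ℝ H x :=
  (hH.contDiffAt hx).differentiableAt (by norm_num)

/-- A continuous function on the unit sphere of a Euclidean space is bounded there. -/
theorem _root_.exists_bound_sphere {g : EuclideanSpace ℝ (Fin N) → ℝ}
    (hg : ContinuousOn g {(0 : EuclideanSpace ℝ (Fin N))}ᶜ) :
    ∃ C : ℝ, 0 ≤ C ∧ ∀ x, ‖x‖ = 1 → g x ≤ C := by
  have hK : IsCompact (Metric.sphere (0 : EuclideanSpace ℝ (Fin N)) 1) := isCompact_sphere _ _
  obtain ⟨C, hC⟩ := (hK.bddAbove_image (hg.mono fun x hx => by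
    rintro rfl
    simp at hx) : BddAbove (g '' Metric.sphere (0 : EuclideanSpace ℝ (Fin N)) 1))
  exact ⟨max C 0, le_max_right _ _, fun x hx =>
    (hC (mem_image_of_mem g (by simpa using hx))).trans (le_max_left _ _)⟩

theorem exists_le_mul_norm (hH : IsFinslerNorm H) :
    ∃ L : ℝ, 0 ≤ L ∧ ∀ x, H x ≤ L * ‖x‖ := by
  obtain ⟨L, hL, h⟩ := exists_bound_sphere hH.2.2.2.1.continuousOn
  refine ⟨L, hL, fun x => ?_⟩
  rcases eq_or_ne x 0 with rfl | hx
  · simp [hH.map_zero]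
  · have hn : 0 < ‖x‖ := norm_pos_iff.2 hx
    have h1 := h (‖x‖⁻¹ • x) (by rw [norm_smul, norm_inv, norm_norm, inv_mul_cancel₀ hn.ne'])
    rw [hH.2.1, abs_of_pos (by positivity), inv_mul_le_iff₀ hn] at h1
    linarith

theorem exists_lipschitz (hH : IsFinslerNorm H) : ∃ L : NNReal, LipschitzWith L H := by
  obtain ⟨L, hL, h⟩ := hH.exists_le_mul_norm
  refine ⟨L.toNNReal, LipschitzWith.of_dist_le_mul fun x y => ?_⟩
  have h1 := hH.2.2.1 (x - y) y
  have h2 := hH.2.2.1 (y - x) x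
  have h3 := h (x - y)
  have h4 := h (y - x)
  rw [sub_add_cancel] at h1 h2
  rw [norm_sub_rev] at h4
  rw [dist_eq_norm, dist_eq_norm, Real.norm_eq_abs, abs_le, Real.coe_toNNReal L hL]
  constructor <;> linarith

theorem continuous (hH : IsFinslerNorm H) : Continuous H :=
  let ⟨_, h⟩ := hH.exists_lipschitz
  h.continuous

theorem exists_abs_inner_gradient_le (hH : IsFinslerNorm H) :
    ∃ L : ℝ, 0 ≤ L ∧ ∀ x v, |⟪gradient H x, v⟫| ≤ L * ‖v‖ := by
  obtain ⟨L, hL⟩ := hH.exists_lipschitz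
  refine ⟨L, L.2, fun x v => ?_⟩
  rw [inner_gradient_left, ← Real.norm_eq_abs]
  exact (fderiv ℝ H x).le_of_opNorm_le (norm_fderiv_le_of_lipschitz ℝ hL) v

theorem measurable_gradient : Measurable (gradient H) :=
  (InnerProductSpace.toDual ℝ _).symm.continuous.measurable.comp (measurable_fderiv ℝ H)

theorem gradient_smul (hH : IsFinslerNorm H) {c : ℝ} (hc : 0 < c)
    (x : EuclideanSpace ℝ (Fin N)) : gradient H (c • x) = gradient H x := by
  have h : (fun y => H (c • y)) = c • H := by
    ext y; rw [hH.2.1, abs_of_pos hc]; rfl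
  have h1 : fderiv ℝ (fun y => H (c • y)) x = c • fderiv ℝ H (c • x) := fderiv_comp_smul c
  rw [h, fderiv_const_smul_field] at h1
  unfold gradient
  rw [← smul_right_injective _ hc.ne' h1]

theorem gradient_zero (hH : IsFinslerNorm H) : gradient H 0 = 0 := by
  have h : (fun y => H ((-1 : ℝ) • y)) = H := by
    ext y; rw [hH.2.1]; simp
  have h1 : fderiv ℝ (fun y => H ((-1 : ℝ) • y)) 0 = (-1 : ℝ) • fderiv ℝ H ((-1 : ℝ) • 0) :=
    fderiv_comp_smul (-1)
  have h2 : fderiv ℝ H 0 = 0 := by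
    ext v
    have h3 := congrArg (fun A => A v) h1
    rw [h, smul_zero] at h3
    simp only [smul_apply, smul_eq_mul] at h3
    rw [zero_apply]
    linarith
  simp [gradient, h2]

/-- Euler's identity for the norm. -/
theorem inner_gradient_self (hH : IsFinslerNorm H) (x : EuclideanSpace ℝ (Fin N)) :
    ⟪gradient H x, x⟫ = H x := by
  rcases eq_or_ne x 0 with rfl | hx
  · simp [hH.map_zero]
  have h1 : HasDerivAt (fun t : ℝ => H (t • x)) (fderiv ℝ H x x) 1 := by
    have hd : HasFDerivAt H (fderiv ℝ H x) ((1 : ℝ) • x) := by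
      rw [one_smul]; exact (hH.differentiableAt hx).hasFDerivAt
    have := hd.comp_hasDerivAt (1 : ℝ) ((hasDerivAt_id (1 : ℝ)).smul_const x)
    simpa [Function.comp_def] using this
  have h2 : HasDerivAt (fun t : ℝ => H (t • x)) (H x) 1 := by
    have h3 : HasDerivAt (fun t : ℝ => t * H x) (H x) 1 := by
      simpa using (hasDerivAt_id (1 : ℝ)).mul_const (H x)
    refine h3.congr_of_eventuallyEq ?_
    filter_upwards [lt_mem_nhds (zero_lt_one : (0 : ℝ) < 1)] with t ht
    rw [hH.2.1, abs_of_pos ht]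
  rw [inner_gradient_left]
  exact h1.unique h2

theorem contDiffAt_gradient (hH : IsFinslerNorm H) {x : EuclideanSpace ℝ (Fin N)} (hx : x ≠ 0) :
    ContDiffAt ℝ 1 (gradient H) x :=
  (InnerProductSpace.toDual ℝ _).symm.contDiff.contDiffAt.comp x
    ((hH.contDiffAt hx).fderiv_right (by norm_num))

theorem hasFDerivAt_gradient (hH : IsFinslerNorm H) {x : EuclideanSpace ℝ (Fin N)}
    (hx : x ≠ 0) : HasFDerivAt (gradient H) (fderiv ℝ (gradient H) x) x :=
  ((hH.contDiffAt_gradient hx).differentiableAt (by norm_num)).hasFDerivAt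

theorem hessian_apply_self (hH : IsFinslerNorm H) {x : EuclideanSpace ℝ (Fin N)} (hx : x ≠ 0) :
    fderiv ℝ (gradient H) x x = 0 := by
  have h1 : HasDerivAt (fun t : ℝ => gradient H (t • x)) (fderiv ℝ (gradient H) x x) 1 := by
    have hd : HasFDerivAt (gradient H) (fderiv ℝ (gradient H) x) ((1 : ℝ) • x) := by
      rw [one_smul]; exact hH.hasFDerivAt_gradient hx
    have := hd.comp_hasDerivAt (1 : ℝ) ((hasDerivAt_id (1 : ℝ)).smul_const x)
    simpa [Function.comp_def] using this
  have h2 : HasDerivAt (fun t : ℝ => gradient H (t • x)) 0 1 := by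
    refine (hasDerivAt_const (1 : ℝ) (gradient H x)).congr_of_eventuallyEq ?_
    filter_upwards [lt_mem_nhds (zero_lt_one : (0 : ℝ) < 1)] with t ht
    exact hH.gradient_smul ht x
  exact h1.unique h2

theorem inner_hessian_self (hH : IsFinslerNorm H) {x : EuclideanSpace ℝ (Fin N)} (hx : x ≠ 0)
    (v : EuclideanSpace ℝ (Fin N)) : ⟪fderiv ℝ (gradient H) x v, x⟫ = 0 := by
  have h1 := (hH.hasFDerivAt_gradient hx).inner ℝ (hasFDerivAt_id x)
  have h2 : HasFDerivAt (fun y => ⟪gradient H y, id y⟫) (fderiv ℝ H x) x := by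
    have : (fun y => ⟪gradient H y, id y⟫) = H := funext fun y => hH.inner_gradient_self y
    rw [this]
    exact (hH.differentiableAt hx).hasFDerivAt
  have h3 := congrArg (fun A => A v) (h1.unique h2)
  simp [inner_gradient_left] at h3
  exact h3

theorem inner_hessian_add_smul (hH : IsFinslerNorm H) {x : EuclideanSpace ℝ (Fin N)} (hx : x ≠ 0)
    (α β : ℝ) (v : EuclideanSpace ℝ (Fin N)) :
    ⟪fderiv ℝ (gradient H) x (α • x + β • v), α • x + β • v⟫ =
      β ^ 2 * ⟪fderiv ℝ (gradient H) x v, v⟫ := by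
  rw [map_add, map_smul, map_smul, hH.hessian_apply_self hx, smul_zero, zero_add,
    inner_add_right, inner_smul_left, inner_smul_left, inner_smul_right, inner_smul_right,
    hH.inner_hessian_self hx]
  simp only [conj_trivial]
  ring

theorem hessian_smul (hH : IsFinslerNorm H) {c : ℝ} (hc : 0 < c)
    (x : EuclideanSpace ℝ (Fin N)) :
    c • fderiv ℝ (gradient H) (c • x) = fderiv ℝ (gradient H) x := by
  have h1 : fderiv ℝ (fun y => gradient H (c • y)) x = c • fderiv ℝ (gradient H) (c • x) :=
    fderiv_comp_smul c
  rw [← h1]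
  congr 1
  exact funext fun y => hH.gradient_smul hc y

theorem exists_mul_inner_hessian_le (hH : IsFinslerNorm H) :
    ∃ C : ℝ, 0 ≤ C ∧ ∀ x, x ≠ 0 → ∀ v,
      H x * |⟪fderiv ℝ (gradient H) x v, v⟫| ≤ C * ‖v‖ ^ 2 := by
  obtain ⟨L, hL, hHL⟩ := hH.exists_le_mul_norm
  have hcont : ContinuousOn (fun x => ‖fderiv ℝ (gradient H) x‖)
      {(0 : EuclideanSpace ℝ (Fin N))}ᶜ := fun x hx =>
    (((hH.contDiffAt_gradient hx).fderiv_right (m := 0) (by norm_num)).continuousAt.norm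
      ).continuousWithinAt
  obtain ⟨M, hM, hb⟩ := exists_bound_sphere hcont
  refine ⟨L * M, by positivity, fun x hx v => ?_⟩
  have hn : 0 < ‖x‖ := norm_pos_iff.2 hx
  have h1 := hb (‖x‖⁻¹ • x) (by rw [norm_smul, norm_inv, norm_norm, inv_mul_cancel₀ hn.ne'])
  have h2 : ‖x‖ * ‖fderiv ℝ (gradient H) x‖ ≤ M := by
    rw [← hH.hessian_smul (inv_pos.2 hn), norm_smul, norm_inv, norm_norm, ← mul_assoc,
      mul_inv_cancel₀ hn.ne', one_mul]
    exact h1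
  have h3 : |⟪fderiv ℝ (gradient H) x v, v⟫| ≤ ‖fderiv ℝ (gradient H) x‖ * ‖v‖ * ‖v‖ :=
    (abs_real_inner_le_norm _ _).trans (by gcongr; exact ContinuousLinearMap.le_opNorm _ _)
  calc H x * |⟪fderiv ℝ (gradient H) x v, v⟫|
      ≤ (L * ‖x‖) * (‖fderiv ℝ (gradient H) x‖ * ‖v‖ * ‖v‖) := by
        gcongr
        exact hHL x
    _ = L * (‖x‖ * ‖fderiv ℝ (gradient H) x‖) * ‖v‖ ^ 2 := by ring
    _ ≤ L * M * ‖v‖ ^ 2 := by gcongr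

end IsFinslerNorm

theorem hasDerivAt_abs_rpow_mul_self {s : ℝ} (hs : 0 < s) (t : ℝ) :
    HasDerivAt (fun t : ℝ => |t| ^ s * t) ((s + 1) * |t| ^ s) t := by
  rcases eq_or_ne t 0 with rfl | ht
  · rw [abs_zero, zero_rpow hs.ne', mul_zero, hasDerivAt_iff_tendsto_slope]
    have h1 : Filter.Tendsto (fun t : ℝ => |t| ^ s) (nhdsWithin 0 {0}ᶜ) (nhds 0) := by
      have : Continuous fun t : ℝ => |t| ^ s := continuous_abs.rpow_const fun _ => Or.inr hs.le
      have h2 := this.tendsto 0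
      rw [abs_zero, zero_rpow hs.ne'] at h2
      exact h2.mono_left nhdsWithin_le_nhds
    refine h1.congr' ?_
    filter_upwards [self_mem_nhdsWithin] with y hy
    have hy' : y ≠ 0 := hy
    simp [slope_def_field, hy']
  · have ha : 0 < |t| := abs_pos.2 ht
    have h1 := ((hasDerivAt_abs ht).rpow_const (p := s) (Or.inl ha.ne')).mul (hasDerivAt_id t)
    refine h1.congr_deriv ?_
    have h2 : |t| ^ (s - 1) * |t| = |t| ^ s := by
      rw [rpow_sub_one ha.ne', div_mul_cancel₀ _ ha.ne']
    have h3 : (SignType.sign t : ℝ) * t = |t| := sign_mul_self t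
    calc _ = s * (|t| ^ (s - 1) * ((SignType.sign t : ℝ) * t)) + |t| ^ s := by
          simp only [id]; ring
      _ = _ := by rw [h3, h2]; ring

theorem contDiff_abs_rpow_mul_self {s : ℝ} (hs : 0 < s) :
    ContDiff ℝ 1 fun t : ℝ => |t| ^ s * t := by
  rw [contDiff_one_iff_deriv]
  refine ⟨fun t => (hasDerivAt_abs_rpow_mul_self hs t).differentiableAt, ?_⟩
  rw [funext fun t => (hasDerivAt_abs_rpow_mul_self hs t).deriv]
  exact continuous_const.mul (continuous_abs.rpow_const fun _ => Or.inr hs.le)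

section TestFunctions

variable {N : ℕ} {u θ η : EuclideanSpace ℝ (Fin N) → ℝ}

theorem continuous_gradient (hu : ContDiff ℝ 1 u) : Continuous (gradient u) :=
  (InnerProductSpace.toDual ℝ _).symm.continuous.comp (hu.continuous_fderiv (by norm_num))

theorem gradient_fun_pow (hη : ContDiff ℝ 1 η) (k : ℕ) (x : EuclideanSpace ℝ (Fin N)) :
    gradient (fun y => η y ^ k) x = (k * η x ^ (k - 1)) • gradient η x := by
  have h := ((hη.differentiable (by norm_num) x).hasFDerivAt.pow k).fderiv
  refine ext_inner_right ℝ fun v => ?_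
  rw [inner_gradient_left, inner_smul_left, inner_gradient_left, h]
  simp

theorem gradient_abs_rpow_mul_self_mul {s : ℝ} (hs : 0 < s) (hu : ContDiff ℝ 1 u)
    (hθ : ContDiff ℝ 1 θ) (x : EuclideanSpace ℝ (Fin N)) :
    gradient (fun y => |u y| ^ s * u y * θ y) x =
      ((s + 1) * |u x| ^ s * θ x) • gradient u x + (|u x| ^ s * u x) • gradient θ x := by
  have h1 := (hasDerivAt_abs_rpow_mul_self hs (u x)).comp_hasFDerivAt x
    (hu.differentiable (by norm_num) x).hasFDerivAt
  have h := (h1.mul (hθ.differentiable (by norm_num) x).hasFDerivAt).fderiv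
  refine ext_inner_right ℝ fun v => ?_
  rw [inner_gradient_left, inner_add_left, inner_smul_left, inner_smul_left, inner_gradient_left,
    inner_gradient_left]
  refine (congrArg (fun A => A v) h).trans ?_
  simp
  ring

theorem contDiff_abs_rpow_mul_self_mul {s : ℝ} (hs : 0 < s) (hu : ContDiff ℝ 1 u)
    (hθ : ContDiff ℝ 1 θ) : ContDiff ℝ 1 fun y => |u y| ^ s * u y * θ y :=
  ((contDiff_abs_rpow_mul_self hs).comp hu).mul hθ

/-- Cut-off functions at scale `R` with gradient of size `1 / R`. -/
theorem exists_cutoff (N : ℕ) :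
    ∃ c : ℝ, 0 ≤ c ∧ ∀ R : ℝ, 0 < R → ∃ η : EuclideanSpace ℝ (Fin N) → ℝ,
      ContDiff ℝ 1 η ∧ (∀ x, 0 ≤ η x) ∧ (∀ x, η x ≤ 1) ∧ (∀ x, ‖x‖ ≤ R → η x = 1) ∧
      (∀ x, 2 * R < ‖x‖ → η x = 0) ∧ ∀ x, ‖gradient η x‖ ≤ c / R := by
  let f : ContDiffBump (0 : EuclideanSpace ℝ (Fin N)) := ⟨1, 2, one_pos, one_lt_two⟩
  have hf : ContDiff ℝ 1 (f : EuclideanSpace ℝ (Fin N) → ℝ) := f.contDiff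
  obtain ⟨c, hc⟩ := (hf.continuous_fderiv (by norm_num)).bounded_above_of_compact_support
    (f.hasCompactSupport.fderiv (𝕜 := ℝ))
  refine ⟨c, (norm_nonneg _).trans (hc 0), fun R hR => ⟨fun x => f (R⁻¹ • x), ?_, ?_, ?_, ?_,
    ?_, ?_⟩⟩
  · exact hf.comp (contDiff_const_smul _)
  · exact fun x => f.nonneg
  · exact fun x => f.le_one
  · intro x hx
    refine f.one_of_mem_closedBall ?_
    rw [mem_closedBall_zero_iff, norm_smul, norm_inv, Real.norm_of_nonneg hR.le,
      inv_mul_le_iff₀ hR]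
    simpa [f] using hx
  · intro x hx
    refine f.zero_of_le_dist ?_
    rw [dist_zero_right, norm_smul, norm_inv, Real.norm_of_nonneg hR.le, le_inv_mul_iff₀ hR]
    simp only [f]
    linarith
  · intro x
    have h : fderiv ℝ (fun x => f (R⁻¹ • x)) x = R⁻¹ • fderiv ℝ f (R⁻¹ • x) :=
      fderiv_comp_smul R⁻¹
    unfold gradient
    rw [LinearIsometryEquiv.norm_map, h, norm_smul, norm_inv, Real.norm_of_nonneg hR.le,
      div_eq_inv_mul]
    gcongr
    exact hc _

end TestFunctions

namespace SatisfiesHB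

variable {B : ℝ → ℝ} {p κ γ Γ : ℝ}

theorem deriv_nonneg (hB : SatisfiesHB B p κ γ Γ) {t : ℝ} (ht : 0 ≤ t) : 0 ≤ deriv B t := by
  rcases ht.eq_or_lt with rfl | h
  · exact hB.2.2.1.ge
  · exact (hB.2.2.2.1 t h).2.1.le

theorem le_deriv (hB : SatisfiesHB B p κ γ Γ) {t : ℝ} (ht : 0 ≤ t) :
    γ * (κ + t) ^ (p - 2) * t ≤ deriv B t := by
  rcases ht.eq_or_lt with rfl | h
  · rw [hB.2.2.1, mul_zero]
  · exact (hB.2.2.2.2.2.2.2.2.2.1 t h).1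

theorem deriv_le (hB : SatisfiesHB B p κ γ Γ) {t : ℝ} (ht : 0 ≤ t) :
    deriv B t ≤ Γ * (κ + t) ^ (p - 2) * t := by
  rcases ht.eq_or_lt with rfl | h
  · rw [hB.2.2.1, mul_zero]
  · exact (hB.2.2.2.2.2.2.2.2.2.1 t h).2

theorem continuousOn_deriv (hB : SatisfiesHB B p κ γ Γ) (hp : 2 ≤ p) :
    ContinuousOn (deriv B) (Ici 0) := by
  intro t ht
  rcases (show (0 : ℝ) ≤ t from ht).eq_or_lt with rfl | h
  · have hc : Continuous fun t : ℝ => Γ * (κ + t) ^ (p - 2) * t :=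
      (continuous_const.mul ((continuous_const.add continuous_id).rpow_const
        fun _ => Or.inr (by linarith))).mul continuous_id
    have h0 := hc.continuousWithinAt (s := Ici 0) (x := 0)
    unfold ContinuousWithinAt at h0 ⊢
    simp only [mul_zero] at h0
    rw [hB.2.2.1]
    refine tendsto_of_tendsto_of_tendsto_of_le_of_le' tendsto_const_nhds h0 ?_ ?_
    · filter_upwards [self_mem_nhdsWithin] with s hs using hB.deriv_nonneg hs
    · filter_upwards [self_mem_nhdsWithin] with s hs using hB.deriv_le hs
  · exact ((hB.1.continuousOn_deriv_of_isOpen isOpen_Ioi (by norm_num)).continuousAt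
      (Ioi_mem_nhds h)).continuousWithinAt

/-- The constant `κ^{2-p} γ⁻¹` dominates the ellipticity ratio `t B''(t) / B'(t)`. -/
theorem gamma_mul_le (hp : 2 ≤ p) (hκ : 0 ≤ κ) (h0 : 0 < Γ * κ ^ (p - 2) * (p - 1))
    (h1 : Γ * κ ^ (p - 2) * (p - 1) < 1) : Γ * (p - 1) ≤ κ ^ (2 - p) := by
  rcases hκ.eq_or_lt with rfl | hκ
  · rcases hp.eq_or_lt with rfl | hp
    · norm_num at h1 ⊢
      linarith
    · rw [zero_rpow (by linarith)] at h0
      simp at h0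
  · have h2 : κ ^ (2 - p) = (κ ^ (p - 2))⁻¹ := by
      rw [← rpow_neg hκ.le]; congr 1; ring
    rw [h2, ← one_div, le_div_iff₀ (rpow_pos_of_pos hκ _)]
    linarith

theorem deriv_deriv_mul_le (hB : SatisfiesHB B p κ γ Γ) (hp : 2 ≤ p)
    (h0 : 0 < Γ * κ ^ (p - 2) * (p - 1)) (h1 : Γ * κ ^ (p - 2) * (p - 1) < 1)
    {t : ℝ} (ht : 0 < t) : deriv (deriv B) t * t ≤ κ ^ (2 - p) * γ⁻¹ * deriv B t := by
  have hg := gamma_mul_le hp hB.2.2.2.2.2.1 h0 h1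
  obtain ⟨-, -, -, -, -, hκ, -, hγ, hΓ, hb1, hb2⟩ := hB
  have hP : 0 ≤ (κ + t) ^ (p - 2) := by positivity
  have hK : 0 ≤ κ ^ (2 - p) := by positivity
  calc deriv (deriv B) t * t ≤ Γ * (p - 1) * (κ + t) ^ (p - 2) * t := by
        gcongr; exact (hb2 t ht).2
    _ ≤ κ ^ (2 - p) * (κ + t) ^ (p - 2) * t := by gcongr
    _ = κ ^ (2 - p) * γ⁻¹ * (γ * (κ + t) ^ (p - 2) * t) := by field_simp
    _ ≤ _ := by gcongr; exact (hb1 t ht).1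

end SatisfiesHB

theorem add_sq_le_one_add_mul {ε : ℝ} (hε : 0 < ε) (x y : ℝ) :
    (x + y) ^ 2 ≤ (1 + ε) * x ^ 2 + (1 + ε⁻¹) * y ^ 2 := by
  have h : (1 + ε) * x ^ 2 + (1 + ε⁻¹) * y ^ 2 - (x + y) ^ 2 = ε⁻¹ * (ε * x - y) ^ 2 := by
    field_simp; ring
  have : 0 ≤ ε⁻¹ * (ε * x - y) ^ 2 := by positivity
  linarith

section Pointwise

variable {N : ℕ} {H : EuclideanSpace ℝ (Fin N) → ℝ} {B : ℝ → ℝ} {p κ γ Γ b ε : ℝ}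

theorem rpow_two_mul_eq_sq (z : ℝ) : |z| ^ (2 * b) = (|z| ^ b) ^ 2 := by
  rw [← rpow_natCast, ← rpow_mul (abs_nonneg z)]
  congr 1; push_cast; ring

theorem exists_radial_term_le (hH : IsFinslerNorm H) (hB : SatisfiesHB B p κ γ Γ) (hp : 2 ≤ p)
    (h0 : 0 < Γ * κ ^ (p - 2) * (p - 1)) (h1 : Γ * κ ^ (p - 2) * (p - 1) < 1)
    (b : ℝ) (hε : 0 < ε) :
    ∃ C : ℝ, 0 ≤ C ∧ ∀ (W V : EuclideanSpace ℝ (Fin N)) (z ψ : ℝ),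
      |deriv (deriv B) (H W) * ⟪gradient H W,
          ((b + 1) * |z| ^ b * ψ) • W + (|z| ^ b * z) • V⟫ ^ 2| ≤
        (1 + ε) * (κ ^ (2 - p) * γ⁻¹ * (b + 1) ^ 2) *
            (deriv B (H W) * H W * |z| ^ (2 * b) * ψ ^ 2) +
          C * ((κ + H W) ^ (p - 2) * |z| ^ (2 * b) * (|z| * ‖V‖) ^ 2) := by
  obtain ⟨L, hL, hgL⟩ := hH.exists_abs_inner_gradient_le
  have hκ : 0 ≤ κ := hB.2.2.2.2.2.1
  have hγ : 0 < γ := hB.2.2.2.2.2.2.2.1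
  have hΓ : 0 < Γ := hB.2.2.2.2.2.2.2.2.1
  have hp1 : 0 ≤ p - 1 := by linarith
  refine ⟨(1 + ε⁻¹) * (Γ * (p - 1) * L ^ 2), by positivity, fun W V z ψ => ?_⟩
  have hH0 := hH.nonneg W
  have hB0 := hB.deriv_nonneg hH0
  have hP : 0 ≤ (κ + H W) ^ (p - 2) := by positivity
  rcases eq_or_ne W 0 with rfl | hW
  · rw [hH.gradient_zero, inner_zero_left]
    simp only [ne_eq, OfNat.ofNat_ne_zero, not_false_eq_true, zero_pow, mul_zero, abs_zero]
    positivity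
  have hHp := hH.pos hW
  have hB2 := (hB.2.2.2.1 (H W) hHp).2.2
  rw [abs_of_nonneg (by positivity), inner_add_right, inner_smul_right, inner_smul_right,
    hH.inner_gradient_self, rpow_two_mul_eq_sq]
  set i := ⟪gradient H W, V⟫ with hi
  set a := |z| ^ b with ha
  have hi2 : i ^ 2 ≤ L ^ 2 * ‖V‖ ^ 2 := by
    rw [← mul_pow, ← sq_abs]
    gcongr
    exact hgL W V
  have hle : deriv (deriv B) (H W) ≤ Γ * (p - 1) * (κ + H W) ^ (p - 2) :=
    (hB.2.2.2.2.2.2.2.2.2.2 (H W) hHp).2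
  calc deriv (deriv B) (H W) * ((b + 1) * a * ψ * H W + a * z * i) ^ 2
      ≤ deriv (deriv B) (H W) *
          ((1 + ε) * ((b + 1) * a * ψ * H W) ^ 2 + (1 + ε⁻¹) * (a * z * i) ^ 2) := by
        gcongr
        exact add_sq_le_one_add_mul hε _ _
    _ = (1 + ε) * ((deriv (deriv B) (H W) * H W) * ((b + 1) ^ 2 * (H W * a ^ 2 * ψ ^ 2))) +
          (1 + ε⁻¹) * (deriv (deriv B) (H W) * (a ^ 2 * z ^ 2 * i ^ 2)) := by ring
    _ ≤ (1 + ε) * ((κ ^ (2 - p) * γ⁻¹ * deriv B (H W)) *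
            ((b + 1) ^ 2 * (H W * a ^ 2 * ψ ^ 2))) +
          (1 + ε⁻¹) * (Γ * (p - 1) * (κ + H W) ^ (p - 2) *
            (a ^ 2 * z ^ 2 * (L ^ 2 * ‖V‖ ^ 2))) := by
        refine add_le_add (mul_le_mul_of_nonneg_left (mul_le_mul_of_nonneg_right
          (hB.deriv_deriv_mul_le hp h0 h1 hHp) (by positivity)) (by positivity)) ?_
        gcongr
    _ = _ := by rw [mul_pow |z|, sq_abs]; ring

theorem exists_tangential_term_le (hH : IsFinslerNorm H) (hB : SatisfiesHB B p κ γ Γ) (b : ℝ) :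
    ∃ C : ℝ, 0 ≤ C ∧ ∀ (W V : EuclideanSpace ℝ (Fin N)) (z ψ : ℝ),
      |deriv B (H W) * ⟪fderiv ℝ (gradient H) W
            (((b + 1) * |z| ^ b * ψ) • W + (|z| ^ b * z) • V),
          ((b + 1) * |z| ^ b * ψ) • W + (|z| ^ b * z) • V⟫| ≤
        C * ((κ + H W) ^ (p - 2) * |z| ^ (2 * b) * (|z| * ‖V‖) ^ 2) := by
  obtain ⟨C, hC, hh⟩ := hH.exists_mul_inner_hessian_le
  have hκ : 0 ≤ κ := hB.2.2.2.2.2.1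
  have hΓ : 0 < Γ := hB.2.2.2.2.2.2.2.2.1
  refine ⟨Γ * C, by positivity, fun W V z ψ => ?_⟩
  have hH0 := hH.nonneg W
  have hB0 := hB.deriv_nonneg hH0
  have hP : 0 ≤ (κ + H W) ^ (p - 2) := by positivity
  rcases eq_or_ne W 0 with rfl | hW
  · rw [hH.map_zero, hB.2.2.1, zero_mul, abs_zero]
    rw [hH.map_zero] at hP
    positivity
  rw [hH.inner_hessian_add_smul hW, abs_mul, abs_mul, abs_of_nonneg hB0,
    abs_of_nonneg (sq_nonneg (|z| ^ b * z)), rpow_two_mul_eq_sq]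
  set a := |z| ^ b with ha
  calc deriv B (H W) * ((a * z) ^ 2 * |⟪fderiv ℝ (gradient H) W V, V⟫|)
      ≤ (Γ * (κ + H W) ^ (p - 2) * H W) *
          ((a * z) ^ 2 * |⟪fderiv ℝ (gradient H) W V, V⟫|) := by
        gcongr
        exact hB.deriv_le hH0
    _ = Γ * (κ + H W) ^ (p - 2) * (a * z) ^ 2 *
          (H W * |⟪fderiv ℝ (gradient H) W V, V⟫|) := by ring
    _ ≤ Γ * (κ + H W) ^ (p - 2) * (a * z) ^ 2 * (C * ‖V‖ ^ 2) := by
        exact mul_le_mul_of_nonneg_left (hh W hW V) (by positivity)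
    _ = _ := by rw [mul_pow |z|, sq_abs]; ring

theorem exists_flux_term_ge (hH : IsFinslerNorm H) (hB : SatisfiesHB B p κ γ Γ) (b : ℝ)
    (hε : 0 < ε) :
    ∃ C : ℝ, 0 ≤ C ∧ ∀ (W V : EuclideanSpace ℝ (Fin N)) (z ψ : ℝ),
      (2 * b + 1 - ε) * (deriv B (H W) * H W * |z| ^ (2 * b) * ψ ^ 2) -
          C * ((κ + H W) ^ (p - 2) * |z| ^ (2 * b) * (|z| * ‖V‖) ^ 2) ≤
        deriv B (H W) * ⟪gradient H W,
          ((2 * b + 1) * |z| ^ (2 * b) * ψ ^ 2) • W + (|z| ^ (2 * b) * z) • (2 * ψ) • V⟫ := by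
  obtain ⟨L, hL, hgL⟩ := hH.exists_abs_inner_gradient_le
  have hκ : 0 ≤ κ := hB.2.2.2.2.2.1
  have hγ : 0 < γ := hB.2.2.2.2.2.2.2.1
  have hΓ : 0 < Γ := hB.2.2.2.2.2.2.2.2.1
  set δ := ε * γ with hδ
  have hδ0 : 0 < δ := by positivity
  refine ⟨(Γ * L) ^ 2 * δ⁻¹, by positivity, fun W V z ψ => ?_⟩
  have hH0 := hH.nonneg W
  have hB0 := hB.deriv_nonneg hH0
  have hP : 0 ≤ (κ + H W) ^ (p - 2) := by positivity
  rw [inner_add_right, inner_smul_right, inner_smul_right, inner_smul_right,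
    hH.inner_gradient_self]
  set i := ⟪gradient H W, V⟫ with hi
  set P := (κ + H W) ^ (p - 2) with hPd
  have ha : 0 ≤ |z| ^ (2 * b) := by positivity
  set a := |z| ^ (2 * b)
  have hcross : deriv B (H W) * (|z| * |ψ| * |i|) * 2 ≤
      δ * P * H W ^ 2 * ψ ^ 2 + (Γ * L) ^ 2 * δ⁻¹ * (P * (|z| * ‖V‖) ^ 2) := by
    have hsq : 0 ≤ P * δ⁻¹ * (δ * (H W * |ψ|) - Γ * L * (|z| * ‖V‖)) ^ 2 := by positivity
    have he : P * δ⁻¹ * (δ * (H W * |ψ|) - Γ * L * (|z| * ‖V‖)) ^ 2 =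
        δ * P * H W ^ 2 * |ψ| ^ 2 + (Γ * L) ^ 2 * δ⁻¹ * (P * (|z| * ‖V‖) ^ 2) -
          (Γ * P * H W) * (|z| * |ψ| * (L * ‖V‖)) * 2 := by
      field_simp
      ring
    have h2 : deriv B (H W) * (|z| * |ψ| * |i|) * 2 ≤
        (Γ * P * H W) * (|z| * |ψ| * (L * ‖V‖)) * 2 := by
      gcongr
      · exact hB.deriv_le hH0
      · exact hgL W V
    rw [sq_abs] at he
    linarith
  have hab : -(|z| * |ψ| * |i|) ≤ z * ψ * i := by
    rw [← abs_mul, ← abs_mul]; exact neg_abs_le _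
  have hA : δ * P * H W ^ 2 * ψ ^ 2 ≤ ε * (deriv B (H W) * H W * ψ ^ 2) := by
    calc δ * P * H W ^ 2 * ψ ^ 2 = ε * ((γ * P * H W) * H W * ψ ^ 2) := by rw [hδ]; ring
      _ ≤ _ := by gcongr; exact hB.le_deriv hH0
  have h3 : -(ε * (deriv B (H W) * H W * ψ ^ 2) + (Γ * L) ^ 2 * δ⁻¹ * (P * (|z| * ‖V‖) ^ 2)) ≤
      deriv B (H W) * (z * ψ * i) * 2 := by
    nlinarith [mul_le_mul_of_nonneg_left hab hB0]
  have h4 := mul_le_mul_of_nonneg_left h3 ha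
  calc _ = (2 * b + 1) * (deriv B (H W) * H W * a * ψ ^ 2) +
        a * -(ε * (deriv B (H W) * H W * ψ ^ 2) +
          (Γ * L) ^ 2 * δ⁻¹ * (P * (|z| * ‖V‖) ^ 2)) := by ring
    _ ≤ (2 * b + 1) * (deriv B (H W) * H W * a * ψ ^ 2) +
        a * (deriv B (H W) * (z * ψ * i) * 2) := by gcongr
    _ = _ := by ring

end Pointwise

section Energy

variable {N : ℕ} {H : EuclideanSpace ℝ (Fin N) → ℝ} {B : ℝ → ℝ}
  {u : EuclideanSpace ℝ (Fin N) → ℝ} {p κ γ Γ q b : ℝ}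

theorem abs_rpow_mul_sq (hq : 1 < q) (hb : 0 < b) (z ψ : ℝ) :
    |z| ^ (q - 1) * (|z| ^ b * z * ψ) ^ 2 = |z| ^ (q + 2 * b + 1) * ψ ^ 2 := by
  have h : |z| ^ (q + 2 * b + 1) = |z| ^ (q - 1) * |z| ^ (2 * b) * |z| ^ 2 := by
    rw [← rpow_add_of_nonneg (abs_nonneg z) (by linarith) (by positivity), ← rpow_two,
      ← rpow_add_of_nonneg (abs_nonneg z) (by linarith) (by norm_num)]
    congr 1; ring
  rw [h, rpow_two_mul_eq_sq, sq_abs]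
  ring

theorem abs_rpow_mul_self_mul (hq : 1 < q) (hb : 0 < b) (z θ : ℝ) :
    |z| ^ (q - 1) * z * (|z| ^ (2 * b) * z * θ) = |z| ^ (q + 2 * b + 1) * θ := by
  have h := abs_rpow_mul_sq hq hb z 1
  rw [one_pow, mul_one, mul_one] at h
  rw [← h, rpow_two_mul_eq_sq]
  ring

theorem continuous_deriv_comp_norm_gradient (hH : IsFinslerNorm H)
    (hB : SatisfiesHB B p κ γ Γ) (hp : 2 ≤ p) (hu : ContDiff ℝ 1 u) :
    Continuous fun x => deriv B (H (gradient u x)) :=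
  (hB.continuousOn_deriv hp).comp_continuous (hH.continuous.comp (continuous_gradient hu))
    fun _ => hH.nonneg _

theorem integrable_flux (hH : IsFinslerNorm H) (hB : SatisfiesHB B p κ γ Γ) (hp : 2 ≤ p)
    (hu : ContDiff ℝ 1 u) {φ : EuclideanSpace ℝ (Fin N) → ℝ} (hφ : ContDiff ℝ 1 φ)
    (hφc : HasCompactSupport φ) :
    Integrable fun x => deriv B (H (gradient u x)) *
      ⟪gradient H (gradient u x), gradient φ x⟫ := by
  obtain ⟨L, hL, hgL⟩ := hH.exists_abs_inner_gradient_le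
  have hc := continuous_deriv_comp_norm_gradient hH hB hp hu
  have hgc : HasCompactSupport (gradient φ) :=
    (hφc.fderiv (𝕜 := ℝ)).comp_left (map_zero _)
  have hint : Integrable fun x => deriv B (H (gradient u x)) * (L * ‖gradient φ x‖) := by
    refine (hc.mul (continuous_const.mul
      (continuous_gradient hφ).norm)).integrable_of_hasCompactSupport ?_
    exact (hgc.norm.mul_left).mul_left
  refine hint.mono' ?_ (Filter.Eventually.of_forall fun x => ?_)
  · exact (hc.measurable.mul ((IsFinslerNorm.measurable_gradient.comp
      (continuous_gradient hu).measurable).inner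
        (continuous_gradient hφ).measurable)).aestronglyMeasurable
  · rw [norm_mul, Real.norm_of_nonneg (hB.deriv_nonneg (hH.nonneg _)), Real.norm_eq_abs]
    exact mul_le_mul_of_nonneg_left (hgL _ _) (hB.deriv_nonneg (hH.nonneg _))

theorem exists_cutoff_energy_le (hH : IsFinslerNorm H) (hB : SatisfiesHB B p κ γ Γ)
    (hp : 2 ≤ p) (hq : 1 < q) (hpq : p - 1 < q) (hu : ContDiff ℝ 1 u)
    (hsol : IsWeakSolutionOn Set.univ B H u q)
    (hstab : IsStableOn Set.univ Set.univ B H u q)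
    (h0 : 0 < Γ * κ ^ (p - 2) * (p - 1)) (h1 : Γ * κ ^ (p - 2) * (p - 1) < 1)
    (hb : 0 < b) (hK0 : 0 < κ ^ (2 - p) * γ⁻¹)
    (hbK : κ ^ (2 - p) * γ⁻¹ * (b + 1) ^ 2 < q * (2 * b + 1)) :
    ∃ C : ℝ, 0 ≤ C ∧ ∀ R : ℝ, 1 ≤ R → ∃ ψ : EuclideanSpace ℝ (Fin N) → ℝ,
      Continuous ψ ∧ HasCompactSupport ψ ∧ (∀ x, 0 ≤ ψ x) ∧ (∀ x, ψ x ≤ 1) ∧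
      (∀ x, ‖x‖ ≤ R → ψ x = 1) ∧ (∀ x, 2 * R < ‖x‖ → ψ x = 0) ∧
      ∫ x, |u x| ^ (q + 2 * b + 1) * ψ x ^ 2 ≤
        C * ∫ x, (Metric.closedBall (0 : EuclideanSpace ℝ (Fin N)) (2 * R)).indicator
          (fun _ => R ^ (-(2 * (q + 2 * b + 1) / (q - 1)))) x := by
  have hκ0 : 0 ≤ κ := hB.2.2.2.2.2.1
  have hκ1 : κ ≤ 1 := hB.2.2.2.2.2.2.1
  have hγ : 0 < γ := hB.2.2.2.2.2.2.2.1
  set K := κ ^ (2 - p) * γ⁻¹ with hKd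
  obtain ⟨ε, hε, hεc, hε2⟩ := exists_small_absorbing hbK (by linarith : 0 < 2 * b + 1)
  obtain ⟨Cr, hCr, hrad⟩ := exists_radial_term_le hH hB hp h0 h1 b
    (show 0 < ε / (2 * (K * (b + 1) ^ 2)) by positivity)
  obtain ⟨Ct, hCt, htan⟩ := exists_tangential_term_le hH hB b
  obtain ⟨Cs, hCs, hflux⟩ := exists_flux_term_ge hH hB b (half_pos hε)
  obtain ⟨c, hc, hcut⟩ := exists_cutoff N
  obtain ⟨m, hm⟩ := exists_nat_ge (max 2 (p * (q + 2 * b + 1) / (q - p + 1)))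
  have hm2 : 2 ≤ m := by exact_mod_cast (le_max_left _ _).trans hm
  set M := Cr + Ct + Cs + 1 with hM
  have hM0 : 0 < M := by positivity
  obtain ⟨C₄, hC₄, herr⟩ := exists_cutoff_error_le (c := m * c)
    (ε := ε / (4 * M * (γ⁻¹ + 1))) hp hκ0 hκ1 hq hpq hb (by positivity) (by positivity) hm2
    ((le_max_right _ _).trans hm)
  have hδ : 0 < (q - ε) * (2 * b + 1 - ε) - (K * (b + 1) ^ 2 + ε) * (1 + ε) := by linarith
  have hKε : 0 < K * (b + 1) ^ 2 + ε := by positivity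
  refine ⟨2 * (M * C₄) * ((K * (b + 1) ^ 2 + ε) + (2 * b + 1 - ε)) /
    ((q - ε) * (2 * b + 1 - ε) - (K * (b + 1) ^ 2 + ε) * (1 + ε)), ?_, fun R hR => ?_⟩
  · have : 0 ≤ 2 * b + 1 - ε := by linarith
    positivity
  have hR0 : 0 < R := by linarith
  obtain ⟨η, hη, hη0, hη1, hηR, hη2R, hgη⟩ := hcut R hR0
  set ψ : EuclideanSpace ℝ (Fin N) → ℝ := fun x => η x ^ m with hψ
  have hψd : ContDiff ℝ 1 ψ := hη.pow m
  have hψ2 : ∀ x, 2 * R < ‖x‖ → ψ x = 0 := fun x hx => by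
    simp only [hψ, hη2R x hx]; exact zero_pow (by omega)
  have hgψ : ∀ x, gradient ψ x = (m * η x ^ (m - 1)) • gradient η x := gradient_fun_pow hη m
  have hψc : HasCompactSupport ψ :=
    HasCompactSupport.intro (isCompact_closedBall 0 (2 * R)) fun x hx =>
      hψ2 x (by simpa using hx)
  refine ⟨ψ, hψd.continuous, hψc, fun x => pow_nonneg (hη0 x) m,
    fun x => pow_le_one₀ (hη0 x) (hη1 x), fun x hx => by simp [hψ, hηR x hx], hψ2, ?_⟩
  set χ : EuclideanSpace ℝ (Fin N) → ℝ :=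
    (Metric.closedBall (0 : EuclideanSpace ℝ (Fin N)) (2 * R)).indicator
          (fun _ => R ^ (-(2 * (q + 2 * b + 1) / (q - 1)))) with hχ
  set A : EuclideanSpace ℝ (Fin N) → ℝ := fun x =>
    deriv B (H (gradient u x)) * H (gradient u x) * |u x| ^ (2 * b) * ψ x ^ 2 with hA
  set Y : EuclideanSpace ℝ (Fin N) → ℝ := fun x => |u x| ^ (q + 2 * b + 1) * ψ x ^ 2 with hY
  set F : EuclideanSpace ℝ (Fin N) → ℝ := fun x =>
    (κ + H (gradient u x)) ^ (p - 2) * |u x| ^ (2 * b) * (|u x| * ‖gradient ψ x‖) ^ 2 with hF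
  have hF0 : ∀ x, 0 ≤ F x := fun x => by
    have := hH.nonneg (gradient u x)
    positivity
  have hA0 : ∀ x, 0 ≤ A x := fun x => by
    have := hH.nonneg (gradient u x)
    have := hB.deriv_nonneg this
    positivity
  have hY0 : ∀ x, 0 ≤ Y x := fun x => by positivity
  have hχ0 : ∀ x, 0 ≤ χ x := fun x => indicator_nonneg (fun _ _ => by positivity) x
  have hFle : ∀ x, M * F x ≤ ε / 4 * (A x + Y x) + M * C₄ * χ x := by
    intro x
    rcases lt_or_ge (2 * R) ‖x‖ with hx | hx
    · have : F x = 0 := by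
        simp only [hF, hgψ, hη2R x hx, zero_pow (show m - 1 ≠ 0 by omega)]
        simp
      rw [this, mul_zero]
      have := hA0 x
      have := hY0 x
      have := hχ0 x
      positivity
    · have hχx : χ x = R ^ (-(2 * (q + 2 * b + 1) / (q - 1))) :=
        indicator_of_mem (by simpa using hx) _
      have hD : ‖gradient ψ x‖ ≤ m * c * η x ^ (m - 1) / R := by
        rw [hgψ, norm_smul, Real.norm_of_nonneg (by have := hη0 x; positivity)]
        calc m * η x ^ (m - 1) * ‖gradient η x‖ ≤ m * η x ^ (m - 1) * (c / R) := by
              have := hη0 x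
              gcongr
              exact hgη x
          _ = _ := by ring
      have h := herr R (H (gradient u x)) |u x| (η x) ‖gradient ψ x‖ hR (hH.nonneg _)
        (abs_nonneg _) (hη0 x) (hη1 x) (norm_nonneg _) hD
      rw [← hχx] at h
      have hPA : (κ + H (gradient u x)) ^ (p - 2) * |u x| ^ (2 * b) * H (gradient u x) ^ 2 *
          (η x ^ m) ^ 2 ≤ γ⁻¹ * A x := by
        have hh := hH.nonneg (gradient u x)
        calc _ = γ⁻¹ * ((γ * (κ + H (gradient u x)) ^ (p - 2) * H (gradient u x)) *
              H (gradient u x) * |u x| ^ (2 * b) * ψ x ^ 2) := by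
              simp only [hψ]; field_simp
          _ ≤ γ⁻¹ * A x := by
              simp only [hA]
              gcongr
              exact hB.le_deriv hh
      have hsum : (κ + H (gradient u x)) ^ (p - 2) * |u x| ^ (2 * b) * H (gradient u x) ^ 2 *
          (η x ^ m) ^ 2 + |u x| ^ (q + 2 * b + 1) * (η x ^ m) ^ 2 ≤
          (γ⁻¹ + 1) * (A x + Y x) := by
        have e : |u x| ^ (q + 2 * b + 1) * (η x ^ m) ^ 2 = Y x := rfl
        have h3 : 0 ≤ γ⁻¹ * Y x := mul_nonneg (by positivity) (hY0 x)
        have h4 := hA0 x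
        rw [e]
        linarith
      calc M * F x ≤ M * (ε / (4 * M * (γ⁻¹ + 1)) * ((γ⁻¹ + 1) * (A x + Y x)) + C₄ * χ x) := by
            refine mul_le_mul_of_nonneg_left (h.trans ?_) hM0.le
            gcongr
        _ = _ := by field_simp
  have hucont := hu.continuous
  have hwp : ∀ s : ℝ, 0 ≤ s → Continuous fun x => |u x| ^ s := fun s hs =>
    hucont.abs.rpow_const fun _ => Or.inr hs
  have hψ2c : HasCompactSupport fun x => ψ x ^ 2 :=
    hψc.comp_left (g := fun t : ℝ => t ^ 2) (by norm_num)
  have hAi : Integrable A :=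
    ((((continuous_deriv_comp_norm_gradient hH hB hp hu).mul
      (hH.continuous.comp (continuous_gradient hu))).mul (hwp _ (by positivity))).mul
      (hψd.continuous.pow 2)).integrable_of_hasCompactSupport hψ2c.mul_left
  have hYi : Integrable Y :=
    ((hwp _ (by linarith)).mul (hψd.continuous.pow 2)).integrable_of_hasCompactSupport
      hψ2c.mul_left
  have hχi : Integrable χ := by
    rw [hχ, integrable_indicator_iff measurableSet_closedBall]
    exact integrableOn_const (isCompact_closedBall _ _).measure_lt_top.ne
  have hS := hstab (fun y => |u y| ^ b * u y * ψ y) (contDiff_abs_rpow_mul_self_mul hb hu hψd)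
    hψc.mul_left (subset_univ _)
  have hW := hsol (fun y => |u y| ^ (2 * b) * u y * ψ y ^ 2)
    (contDiff_abs_rpow_mul_self_mul (by positivity) hu (hψd.pow 2)) hψ2c.mul_left (subset_univ _)
  have hfi := integrable_flux hH hB hp hu
    (contDiff_abs_rpow_mul_self_mul (by positivity : 0 < 2 * b) hu (hψd.pow 2)) hψ2c.mul_left
  have hgrad : ∀ x, gradient (fun y => |u y| ^ (2 * b) * u y * ψ y ^ 2) x =
      ((2 * b + 1) * |u x| ^ (2 * b) * ψ x ^ 2) • gradient u x +
        (|u x| ^ (2 * b) * u x) • (2 * ψ x) • gradient ψ x := by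
    intro x
    rw [gradient_abs_rpow_mul_self_mul (by positivity) hu (hψd.pow 2), gradient_fun_pow hψd 2]
    norm_num
  simp only [setIntegral_univ, gradient_abs_rpow_mul_self_mul hb hu hψd, mul_assoc q,
    abs_rpow_mul_sq hq hb] at hS
  simp only [setIntegral_univ, abs_rpow_mul_self_mul hq hb, hgrad] at hW
  simp only [hgrad] at hfi
  rw [integral_const_mul] at hS
  have hI : ∀ a₁ a₂ a₃ : ℝ, Integrable (fun x => a₁ * A x + a₂ * Y x + a₃ * χ x) ∧
      ∫ x, (a₁ * A x + a₂ * Y x + a₃ * χ x) =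
        a₁ * (∫ x, A x) + a₂ * (∫ x, Y x) + a₃ * ∫ x, χ x := by
    intro a₁ a₂ a₃
    have hi := (hAi.const_mul a₁).add (hYi.const_mul a₂)
    refine ⟨hi.add (hχi.const_mul a₃), ?_⟩
    refine (integral_add hi (hχi.const_mul a₃)).trans ?_
    refine (congrArg (· + _) (integral_add (hAi.const_mul a₁) (hYi.const_mul a₂))).trans ?_
    rw [integral_const_mul, integral_const_mul, integral_const_mul]
  obtain ⟨hi₁, he₁⟩ := hI (K * (b + 1) ^ 2 + ε / 2 + ε / 4) (ε / 4) (M * C₄)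
  obtain ⟨hi₂, he₂⟩ := hI (ε / 4) (ε / 4) (M * C₄)
  obtain ⟨hi₃, he₃⟩ := hI (2 * b + 1 - ε / 2 - ε / 4) (-(ε / 4)) (-(M * C₄))
  have hr := norm_integral_le_of_norm_le hi₁ (Filter.Eventually.of_forall fun x =>
    show ‖deriv (deriv B) (H (gradient u x)) * ⟪gradient H (gradient u x),
        ((b + 1) * |u x| ^ b * ψ x) • gradient u x + (|u x| ^ b * u x) • gradient ψ x⟫ ^ 2‖ ≤ _
    from by
      have hle := hrad (gradient u x) (gradient ψ x) (u x) (ψ x)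
      have he : (1 + ε / (2 * (K * (b + 1) ^ 2))) * (K * (b + 1) ^ 2) =
          K * (b + 1) ^ 2 + ε / 2 := by field_simp
      have hCF : Cr * F x ≤ M * F x :=
        mul_le_mul_of_nonneg_right (by linarith) (hF0 x)
      have := hFle x
      rw [he] at hle
      rw [Real.norm_eq_abs]
      calc _ ≤ (K * (b + 1) ^ 2 + ε / 2) * A x + Cr * F x := hle
        _ ≤ _ := by linarith)
  have ht := norm_integral_le_of_norm_le hi₂ (Filter.Eventually.of_forall fun x =>
    show ‖deriv B (H (gradient u x)) * ⟪fderiv ℝ (gradient H) (gradient u x)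
        (((b + 1) * |u x| ^ b * ψ x) • gradient u x + (|u x| ^ b * u x) • gradient ψ x),
        ((b + 1) * |u x| ^ b * ψ x) • gradient u x + (|u x| ^ b * u x) • gradient ψ x⟫‖ ≤ _
    from by
      have hle := htan (gradient u x) (gradient ψ x) (u x) (ψ x)
      have hCF : Ct * F x ≤ M * F x :=
        mul_le_mul_of_nonneg_right (by linarith) (hF0 x)
      have := hFle x
      rw [Real.norm_eq_abs]
      calc _ ≤ Ct * F x := hle
        _ ≤ _ := by linarith)
  have hf := integral_mono hi₃ hfi fun x => by
    have hle := hflux (gradient u x) (gradient ψ x) (u x) (ψ x)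
    have hCF : Cs * F x ≤ M * F x :=
      mul_le_mul_of_nonneg_right (by linarith) (hF0 x)
    have := hFle x
    calc _ ≤ (2 * b + 1 - ε / 2) * A x - Cs * F x := by linarith
      _ ≤ _ := hle
  rw [he₁] at hr
  rw [he₂] at ht
  rw [he₃, hW] at hf
  have hr' := (le_abs_self _).trans hr
  have ht' := (le_abs_self _).trans ht
  have hYint : 0 ≤ ∫ x, Y x := integral_nonneg hY0
  have hs : (q - ε) * (∫ x, Y x) ≤ (K * (b + 1) ^ 2 + ε) * (∫ x, A x) +
      2 * (M * C₄) * ∫ x, χ x := by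
    have := mul_nonneg hε.le hYint
    linarith
  have hfl : (2 * b + 1 - ε) * (∫ x, A x) ≤ (1 + ε) * (∫ x, Y x) + 2 * (M * C₄) * ∫ x, χ x := by
    have h2 := mul_nonneg hε.le hYint
    have h3 := mul_nonneg hε.le (integral_nonneg hA0 : 0 ≤ ∫ x, A x)
    have h4 : 0 ≤ M * C₄ * (∫ x, χ x) :=
      mul_nonneg (by positivity) (integral_nonneg hχ0)
    have h5 : ∫ x, |u x| ^ (q + 2 * b + 1) * ψ x ^ 2 = ∫ x, Y x := rfl
    rw [h5] at hf
    linarith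
  rw [div_mul_eq_mul_div, le_div_iff₀ hδ]
  have h6 := mul_le_mul_of_nonneg_left hs (sub_pos.2 hεc).le
  have h7 := mul_le_mul_of_nonneg_left hfl hKε.le
  linarith

end Energy

/-- Theorem 1.3(ii): Liouville theorem for stable solutions, case `0 < Γ κ^{p-2}(p-1) < 1`. -/
theorem liouville_stable_case_ii {N : ℕ} (hN : 2 ≤ N)
    (H : EuclideanSpace ℝ (Fin N) → ℝ) (B : ℝ → ℝ)
    (u : EuclideanSpace ℝ (Fin N) → ℝ) (p κ γ Γ q : ℝ)
    (hH : IsFinslerNorm H) (hB : SatisfiesHB B p κ γ Γ) (hp : 2 ≤ p) (hq : 1 < q)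
    (hu : ContDiff ℝ 1 u)
    (hsol : IsWeakSolutionOn Set.univ B H u q)
    (hstab : IsStableOn Set.univ Set.univ B H u q)
    (h0 : 0 < Γ * κ ^ (p - 2) * (p - 1)) (h1 : Γ * κ ^ (p - 2) * (p - 1) < 1)
    (h2 : κ ^ (2 - p) * γ⁻¹ < q)
    (hNf : (N : ℝ) < 2 * (κ ^ (2 - p) * γ⁻¹ * (q - 1) + 2 * q +
        2 * Real.sqrt (q * (q - κ ^ (2 - p) * γ⁻¹))) / (κ ^ (2 - p) * γ⁻¹ * (q - 1))) :
    ∀ x, u x = 0 := by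
  have hγ : 0 < γ := hB.2.2.2.2.2.2.2.1
  have hγΓ : γ ≤ Γ := by
    have h := hB.2.2.2.2.2.2.2.2.2.1 1 one_pos
    have hP : 0 < (κ + 1) ^ (p - 2) := rpow_pos_of_pos (by linarith [hB.2.2.2.2.2.1]) _
    have h' := h.1.trans h.2
    rw [mul_one, mul_one] at h'
    exact le_of_mul_le_mul_right h' hP
  have hpK : p - 1 ≤ κ ^ (2 - p) * γ⁻¹ := by
    rw [← div_eq_mul_inv, le_div_iff₀ hγ]
    have := SatisfiesHB.gamma_mul_le hp hB.2.2.2.2.2.1 h0 h1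
    nlinarith
  have hK0 : 0 < κ ^ (2 - p) * γ⁻¹ := by linarith
  obtain ⟨b, hb, hbK, hNb⟩ := exists_exponent hq hK0 h2 hNf
  obtain ⟨C, hC, henergy⟩ := exists_cutoff_energy_le hH hB hp hq (hpK.trans_lt h2) hu hsol hstab
    h0 h1 hb hK0 hbK
  set s := 2 * (q + 2 * b + 1) / (q - 1) with hs
  set ρ := q + 2 * b + 1 with hρ
  have hρ0 : 0 < ρ := by linarith
  have hcont : Continuous fun x => |u x| ^ ρ := hu.continuous.abs.rpow_const fun _ => Or.inr hρ0.le
  intro x₀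
  by_contra hx₀
  set R₀ := max 1 ‖x₀‖ with hR₀
  have hR₀1 : 1 ≤ R₀ := le_max_left _ _
  obtain ⟨ψ, hψ, hψc, hψ0, hψ1, hψR, hψ2R, -⟩ := henergy R₀ hR₀1
  have hint : ∀ ψ : EuclideanSpace ℝ (Fin N) → ℝ, Continuous ψ → HasCompactSupport ψ →
      Continuous (fun x => |u x| ^ ρ * ψ x ^ 2) ∧
      HasCompactSupport fun x => |u x| ^ ρ * ψ x ^ 2 := fun ψ hψ hψc =>
    ⟨hcont.mul (hψ.pow 2), (hψc.comp_left (g := fun t : ℝ => t ^ 2) (by norm_num)).mul_left⟩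
  have hpos : 0 < ∫ x, |u x| ^ ρ * ψ x ^ 2 := by
    refine (hint ψ hψ hψc).1.integral_pos_of_hasCompactSupport_nonneg_nonzero
      (hint ψ hψ hψc).2 (fun x => by positivity) (x := x₀) ?_
    rw [hψR x₀ (le_max_right _ _), one_pow, mul_one]
    exact (rpow_pos_of_pos (abs_pos.2 hx₀) _).ne'
  set v := volume.real (Metric.ball (0 : EuclideanSpace ℝ (Fin N)) 1) with hv
  have hbound : ∀ R : ℝ, 2 * R₀ ≤ R →
      ∫ x, |u x| ^ ρ * ψ x ^ 2 ≤ C * (2 ^ N * v) * R ^ (-(s - N)) := by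
    intro R hR
    have hR1 : 1 ≤ R := by linarith
    have hR0 : 0 < R := by linarith
    obtain ⟨φ, hφ, hφc, hφ0, hφ1, hφR, hφ2R, hφe⟩ := henergy R hR1
    calc ∫ x, |u x| ^ ρ * ψ x ^ 2 ≤ ∫ x, |u x| ^ ρ * φ x ^ 2 := by
          refine integral_mono ((hint ψ hψ hψc).1.integrable_of_hasCompactSupport
            (hint ψ hψ hψc).2) ((hint φ hφ hφc).1.integrable_of_hasCompactSupport
            (hint φ hφ hφc).2) fun x => ?_
          have h3 : ψ x ≤ φ x := by
            rcases le_or_gt ‖x‖ R with hx | hx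
            · rw [hφR x hx]; exact hψ1 x
            · rw [hψ2R x (by linarith)]; exact hφ0 x
          have := hψ0 x
          dsimp only
          gcongr
      _ ≤ _ := hφe
      _ = _ := by
          rw [integral_indicator_const _ Metric.isClosed_closedBall.measurableSet,
            Measure.addHaar_real_closedBall _ _ (by linarith), finrank_euclideanSpace_fin,
            smul_eq_mul, mul_pow, neg_sub, sub_eq_add_neg (N : ℝ) s, rpow_add hR0, rpow_natCast]
          ring
  have hlim : Filter.Tendsto (fun R : ℝ => C * (2 ^ N * v) * R ^ (-(s - N))) Filter.atTop
      (nhds 0) := by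
    simpa using (tendsto_rpow_neg_atTop (sub_pos.2 hNb)).const_mul (C * (2 ^ N * v))
  have := ge_of_tendsto hlim ((Filter.eventually_ge_atTop (2 * R₀)).mono hbound)
  linarith
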